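/- Let n be a nonnegative integer, let x be a nonzero rational number, and define W_n(x) = Σ_{k=0}^{n} C(-x,k)·C(x-1,k)·H_k^{(2)} and w_n(x) = Σ_{k=0}^{n} C(-x,k)·C(x-1,k)·H_k^{(2)}/(2k+1). Then W_n(x) + W_n(x+1) = 2·C(x-1,n)·C(-x-1,n)·(H_n^{(2)} + 1/x²) − 2/x², and (2x+1)·w_n(x+1) − (2x-1)·w_n(x) = 2·C(x-1,n)·C(-x-1,n)·(H_n^{(2)} + 1/x²) − 2/x². -/

import Mathlib

open Finset

/-- Generalized binomial coefficient `C(a,k) = a(a-1)⋯(a-k+1)/k!` for a rational `a`. -/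
noncomputable def gchoose (a : ℚ) (k : ℕ) : ℚ :=
  (∏ j ∈ Finset.range k, (a - j)) / (Nat.factorial k : ℚ)

/-- The harmonic number `H_k = ∑_{j=1}^k 1/j`. -/
def harm (k : ℕ) : ℚ := ∑ j ∈ Finset.range k, (1 : ℚ) / (j + 1)

/-- The second-order harmonic number `H_k^{(2)} = ∑_{j=1}^k 1/j²`. -/
def harm2 (k : ℕ) : ℚ := ∑ j ∈ Finset.range k, (1 : ℚ) / (j + 1) ^ 2

/-- `x ≡ y (mod p^m)` for rationals: the p-adic valuation of `x - y` is at least `m`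
(with the convention that the valuation of `0` is `+∞`). -/
def CongrMod (p m : ℕ) (x y : ℚ) : Prop :=
  x = y ∨ (m : ℤ) ≤ padicValRat p (x - y)

/-- The Bernoulli polynomial `B_n` evaluated at a rational `x`. -/
noncomputable def bpoly (n : ℕ) (x : ℚ) : ℚ := (Polynomial.bernoulli n).eval x

/-- The Euler polynomial `E_n` evaluated at a rational `x`, via
`E_n(x) = (2/(n+1))·(B_{n+1}(x) − 2^{n+1}·B_{n+1}(x/2))`. -/
noncomputable def epoly (n : ℕ) (x : ℚ) : ℚ :=
  (2 / (n + 1 : ℚ)) * (bpoly (n + 1) x - 2 ^ (n + 1) * bpoly (n + 1) (x / 2))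

/-- The Euler number `E_n = 2^n · E_n(1/2)`. -/
noncomputable def eulerNum (n : ℕ) : ℚ := 2 ^ n * epoly n (1 / 2)

theorem gchoose_succ (a : ℚ) (k : ℕ) :
    gchoose a (k + 1) = gchoose a k * (a - k) / (k + 1) := by
  unfold gchoose
  rw [Finset.prod_range_succ, Nat.factorial_succ]
  push_cast
  field_simp

theorem gchoose_succ_eq_mul_gchoose_sub_one (a : ℚ) (k : ℕ) :
    gchoose a (k + 1) = a * gchoose (a - 1) k / (k + 1) := by
  unfold gchoose
  rw [Finset.prod_range_succ', Nat.factorial_succ,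
    Finset.prod_congr rfl fun j _ => show a - ((j + 1 : ℕ) : ℚ) = a - 1 - j by push_cast; ring]
  push_cast
  field_simp
  ring

theorem harm2_succ (k : ℕ) : harm2 (k + 1) = harm2 k + 1 / (k + 1) ^ 2 :=
  Finset.sum_range_succ _ k

theorem gchoose_neg_mul_gchoose_sub_one_succ (x : ℚ) (k : ℕ) :
    gchoose (-x) (k + 1) * gchoose (x - 1) (k + 1) =
      -x * (x - (k + 1)) / (k + 1) ^ 2 * (gchoose (x - 1) k * gchoose (-x - 1) k) := by
  rw [gchoose_succ_eq_mul_gchoose_sub_one (-x), gchoose_succ (x - 1)]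
  field_simp
  ring

theorem gchoose_neg_sub_one_mul_gchoose_succ (x : ℚ) (k : ℕ) :
    gchoose (-x - 1) (k + 1) * gchoose x (k + 1) =
      -x * (x + (k + 1)) / (k + 1) ^ 2 * (gchoose (x - 1) k * gchoose (-x - 1) k) := by
  rw [gchoose_succ_eq_mul_gchoose_sub_one x, gchoose_succ (-x - 1)]
  field_simp
  ring

theorem two_mul_gchoose_mul_harm2_succ (x : ℚ) (hx : x ≠ 0) (k : ℕ) :
    2 * gchoose (x - 1) (k + 1) * gchoose (-x - 1) (k + 1) * (harm2 (k + 1) + 1 / x ^ 2) =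
      2 * gchoose (x - 1) k * gchoose (-x - 1) k * (harm2 k + 1 / x ^ 2) -
        2 * x ^ 2 / (k + 1) ^ 2 * (gchoose (x - 1) k * gchoose (-x - 1) k) * harm2 (k + 1) := by
  rw [gchoose_succ, gchoose_succ, harm2_succ]
  field_simp
  ring

theorem stmt_18 (n : ℕ) (x : ℚ) (hx : x ≠ 0) :
    ((∑ k ∈ Finset.range (n + 1), gchoose (-x) k * gchoose (x - 1) k * harm2 k) +
      (∑ k ∈ Finset.range (n + 1), gchoose (-(x + 1)) k * gchoose ((x + 1) - 1) k * harm2 k) =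
      2 * gchoose (x - 1) n * gchoose (-x - 1) n * (harm2 n + 1 / x ^ 2) - 2 / x ^ 2) ∧
    ((2 * x + 1) *
        (∑ k ∈ Finset.range (n + 1),
          gchoose (-(x + 1)) k * gchoose ((x + 1) - 1) k * harm2 k / (2 * k + 1)) -
      (2 * x - 1) *
        (∑ k ∈ Finset.range (n + 1),
          gchoose (-x) k * gchoose (x - 1) k * harm2 k / (2 * k + 1)) =
      2 * gchoose (x - 1) n * gchoose (-x - 1) n * (harm2 n + 1 / x ^ 2) - 2 / x ^ 2) := by
  have hneg : -(x + 1) = -x - 1 := by ring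
  rw [hneg, add_sub_cancel_right]
  constructor
  · induction n with
    | zero => simp [gchoose, harm2]; ring
    | succ n ih =>
      rw [Finset.sum_range_succ _ (n + 1), Finset.sum_range_succ _ (n + 1),
        two_mul_gchoose_mul_harm2_succ x hx, gchoose_neg_mul_gchoose_sub_one_succ,
        gchoose_neg_sub_one_mul_gchoose_succ]
      linear_combination ih
  · induction n with
    | zero => simp [gchoose, harm2]; ring
    | succ n ih =>
      have hn : (2 * ((n + 1 : ℕ) : ℚ) + 1) ≠ 0 := by positivity
      rw [Finset.sum_range_succ _ (n + 1), Finset.sum_range_succ _ (n + 1),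
        two_mul_gchoose_mul_harm2_succ x hx, gchoose_neg_mul_gchoose_sub_one_succ,
        gchoose_neg_sub_one_mul_gchoose_succ]
      have hterm (p h : ℚ) :
          (2 * x + 1) * (-x * (x + (n + 1)) / (n + 1) ^ 2 * p * h / (2 * (n + 1 : ℕ) + 1)) -
            (2 * x - 1) * (-x * (x - (n + 1)) / (n + 1) ^ 2 * p * h / (2 * (n + 1 : ℕ) + 1)) =
          -(2 * x ^ 2 / (n + 1) ^ 2 * p * h) := by
        field_simp
        push_cast
        ring
      linear_combination ih + hterm (gchoose (x - 1) n * gchoose (-x - 1) n) (harm2 (n + 1))
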